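/- Let F be a field of characteristic 2 and let P_n : Fields/F → Sets be the functor assigning to each field extension K/F the set of K-isomorphism classes of n-fold quadratic Pfister forms over K. Then the essential dimension of P_n equals n: ed(P_n) = n. -/

import Mathlib

/-!
Statement 4: Let `F` be a field of characteristic `2` and let `P_n : Fields/F → Sets` be the
functor assigning to each field extension `K/F` the set of `K`-isomorphism classes of `n`-fold
quadratic Pfister forms over `K`.  Then `ed(P_n) = n`.

An `n`-fold quadratic Pfister form over `K` is `⟨⟨a₁, …, a_{n−1}, aₙ]] =
⟨1,a₁⟩ ⊗ ⋯ ⊗ ⟨1,a_{n−1}⟩ ⊗ [1,aₙ]` with `a₁, …, a_{n−1} ∈ Kˣ` and `aₙ ∈ K`.  An isomorphism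
class over `K` is defined over an intermediate field `E` precisely when it is represented by an
`n`-fold quadratic Pfister form with coefficients in `E`, i.e. when there are coefficients in
`E` whose associated Pfister form over `K` is isometric to the given one.
-/

universe u

noncomputable section

/-- The Gram matrix of the `(m+1)`-fold quadratic Pfister form
`⟨⟨a₁, …, a_m, b]] = ⟨1,a₁⟩ ⊗ ⋯ ⊗ ⟨1,a_m⟩ ⊗ [1,b]` in its natural basis: it is the orthogonal
sum, over the subsets `S ⊆ {1,…,m}` (encoded as `S : Fin m → Bool`), of the binary forms
`c_S · [1, b]` with `c_S = ∏_{i ∈ S} a_i`, where `[1,b]` is the binary quadratic form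
`(x, y) ↦ x² + xy + by²`. -/
def pfisterMatrix {K : Type*} [Field K] {m : ℕ} (a : Fin m → K) (b : K) :
    Matrix ((Fin m → Bool) × Bool) ((Fin m → Bool) × Bool) K :=
  fun r c =>
    if r.1 = c.1 then
      (∏ i, if r.1 i then a i else 1) *
        (if r.2 then (if c.2 then b else 0) else 1)
    else 0

/-- The `(m+1)`-fold quadratic Pfister form
`⟨⟨a₁, …, a_m, b]] = ⟨1,a₁⟩ ⊗ ⋯ ⊗ ⟨1,a_m⟩ ⊗ [1,b]`, as a quadratic form in `2^(m+1)`
variables given by `v ↦ vᵀ M v` for its Gram matrix `M`. -/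
def quadPfister {K : Type*} [Field K] {m : ℕ} (a : Fin m → K) (b : K) :
    QuadraticForm K (((Fin m → Bool) × Bool) → K) :=
  (pfisterMatrix a b).toQuadraticMap'

/-- `trdeg_F E ≤ n`: there are at most `n` elements of `E` over which `E` is algebraic. -/
def TrdegLE (F E : Type*) [Field F] [Field E] [Algebra F E] (n : ℕ) : Prop :=
  ∃ s : Finset E, s.card ≤ n ∧
    Algebra.IsAlgebraic (IntermediateField.adjoin F (s : Set E)) E

/-- `ed(P_n) ≤ m`: for every field extension `K/F`, every isomorphism class of `n`-fold
quadratic Pfister forms over `K` is defined over an intermediate field `F ⊆ E ⊆ K` with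
`trdeg_F E ≤ m`, i.e. it is represented by a Pfister form with coefficients in `E`. -/
def pfisterEdLE (F : Type u) [Field F] (n m : ℕ) : Prop :=
  ∀ (K : Type u) [Field K] [Algebra F K] (a : Fin (n - 1) → Kˣ) (b : K),
    ∃ E : IntermediateField F K, TrdegLE F E m ∧
      ∃ (a' : Fin (n - 1) → (↥E)ˣ) (b' : ↥E),
        QuadraticMap.Equivalent
          (quadPfister (fun i => algebraMap (↥E) K (a' i)) (algebraMap (↥E) K b'))
          (quadPfister (fun i => (a i : K)) b)

theorem aux_quad {K : Type*} [Field K] {m : ℕ} (a : Fin m → K) (b : K) (x) :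
    quadPfister a b x = ∑ r, ∑ c, pfisterMatrix a b r c * (x r * x c) := by
  simp only [quadPfister, Matrix.toQuadraticMap', Matrix.toQuadraticForm', LinearMap.BilinMap.toQuadraticMap_apply,
    Matrix.toLinearMap₂'_apply]
  refine Finset.sum_congr rfl fun i _ => Finset.sum_congr rfl fun j _ => ?_
  simp only [smul_eq_mul]
  ring

theorem aux_quad2 {K : Type*} [Field K] {m : ℕ} (a : Fin m → K) (b : K) (x) :
    quadPfister a b x = ∑ r : (Fin m → Bool) × Bool, pfisterMatrix a b r r * (x r * x r) +
      ∑ S, pfisterMatrix a b (S, false) (S, false) * (x (S, false) * x (S, true)) := by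
  rw [aux_quad]
  simp only [Fintype.sum_prod_type, Fintype.sum_bool]
  rw [← Finset.sum_add_distrib]
  refine Finset.sum_congr rfl fun S _ => ?_
  simp only [pfisterMatrix, Finset.sum_add_distrib]
  simp [Finset.sum_ite_eq, ite_mul]
  ring

theorem aux_growth (p : ℕ → ℕ) (N m : ℕ) (h0 : 0 < p 0) (hp : ∀ d, p d ≤ N * (d + 1) ^ m) (c : ℕ) :
    ∃ d, p (2 * d + c) < 2 ^ (m + 1) * p d := by
  by_contra! h
  have key : ∀ j, 2 ^ ((m + 1) * j) ≤ p ((2 ^ j - 1) * c) := by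
    intro j
    induction j with
    | zero => simpa using Nat.succ_le_of_lt h0
    | succ j ih =>
      have h1 := h ((2 ^ j - 1) * c)
      have h2 : 2 * ((2 ^ j - 1) * c) + c = (2 ^ (j + 1) - 1) * c := by
        obtain ⟨q, hq⟩ : ∃ q, 2 ^ j = q + 1 := ⟨2 ^ j - 1, by have := Nat.one_le_two_pow (n := j); omega⟩
        have h3 : 2 ^ (j + 1) - 1 = 2 * q + 1 := by rw [pow_succ]; omega
        rw [h3, hq]; simp; ring
      rw [h2] at h1
      calc 2 ^ ((m + 1) * (j + 1)) = 2 ^ (m + 1) * 2 ^ ((m + 1) * j) := by ring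
        _ ≤ _ := Nat.mul_le_mul_left _ ih
        _ ≤ _ := h1
  have key2 : ∀ j, 2 ^ j ≤ N * (c + 1) ^ m := by
    intro j
    have h1 := (key j).trans (hp _)
    have h2 : (2 ^ j - 1) * c + 1 ≤ 2 ^ j * (c + 1) := by
      obtain ⟨q, hq⟩ : ∃ q, 2 ^ j = q + 1 := ⟨2 ^ j - 1, by have := Nat.one_le_two_pow (n := j); omega⟩
      rw [hq]; simp; nlinarith
    have h3 : 2 ^ (m * j) * 2 ^ j ≤ 2 ^ (m * j) * (N * (c + 1) ^ m) := by
      calc 2 ^ (m * j) * 2 ^ j = 2 ^ ((m + 1) * j) := by ring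
        _ ≤ _ := h1
        _ ≤ N * (2 ^ j * (c + 1)) ^ m := Nat.mul_le_mul_left _ (Nat.pow_le_pow_left h2 _)
        _ = _ := by rw [mul_pow, ← pow_mul]; ring
    exact Nat.le_of_mul_le_mul_left h3 (by positivity)
  have := key2 (N * (c + 1) ^ m)
  exact absurd (Nat.lt_two_pow_self (n := N * (c + 1) ^ m)) (by omega)

theorem aux_linInd {F E Γ : Type*} [Field F] [Field E] [Algebra F E]
    [AddCommGroup Γ] [LinearOrder Γ] [IsOrderedAddMonoid Γ]
    (v : AddValuation E (WithTop Γ)) (hv : ∀ c : F, c ≠ 0 → v (algebraMap F E c) = 0)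
    {I : Type*} (x : I → E) (hx : ∀ i, x i ≠ 0) (hinj : Function.Injective fun i => v (x i)) :
    LinearIndependent F x := by
  classical
  rw [linearIndependent_iff']
  intro s g hg
  by_contra! hne
  obtain ⟨i0, hi0, hgi0⟩ := hne
  obtain ⟨i, hi, hmin⟩ := Finset.exists_min_image (s.filter fun i => g i ≠ 0) (fun i => v (x i))
    ⟨i0, by simp [hi0, hgi0]⟩
  simp only [Finset.mem_filter] at hi hmin
  have hval : ∀ j, g j ≠ 0 → v (g j • x j) = v (x j) := by
    intro j hj
    rw [Algebra.smul_def, v.map_mul, hv _ hj, zero_add]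
  have hlt : v (x i) < v (∑ j ∈ s.erase i, g j • x j) := by
    apply v.map_lt_sum
    · rw [Ne, v.top_iff]; exact hx i
    · intro j hj
      rw [Finset.mem_erase] at hj
      by_cases h : g j = 0
      · rw [h, zero_smul, v.map_zero, lt_top_iff_ne_top, Ne, v.top_iff]; exact hx i
      · rw [hval j h]
        exact lt_of_le_of_ne (hmin j ⟨hj.2, h⟩) (fun h' => hj.1 (hinj h'.symm))
  rw [← Finset.add_sum_erase _ _ hi.1] at hg
  have h1 := v.map_add_eq_of_lt_left (x := g i • x i)
    (y := ∑ j ∈ s.erase i, g j • x j) (by rw [hval i hi.2]; exact hlt)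
  rw [hg, v.map_zero, hval i hi.2] at h1
  exact hx i (v.top_iff.1 h1.symm)

theorem aux_dim {F V T : Type*} [Field F] [AddCommGroup V] [Module F V] [FiniteDimensional F V]
    [LinearOrder T] (α : V → T)
    (hα : ∀ x y, x ≠ 0 → y ≠ 0 → α x = α y → ∃ c : F, x - c • y ≠ 0 → α x < α (x - c • y)) :
    ∀ (t : ℕ) (S : Finset T) (U : Submodule F V), S.card = t → (∀ x ∈ U, x ≠ 0 → α x ∈ S) →
      Module.finrank F U ≤ t := by
  classical
  intro t
  induction t with
  | zero =>
    intro S U hS hU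
    have : U = ⊥ := by
      rw [eq_bot_iff]
      intro x hx
      by_contra hx0
      have := hU x hx hx0
      rw [Finset.card_eq_zero.1 hS] at this
      exact absurd this (Finset.notMem_empty _)
    rw [this, finrank_bot]
  | succ t ih =>
    intro S U hS hU
    by_cases hbot : U = ⊥
    · rw [hbot, finrank_bot]; exact Nat.zero_le _
    obtain ⟨x0, hx0, hx0'⟩ := U.ne_bot_iff.1 hbot
    obtain ⟨τ, hτ, hmax⟩ := Finset.exists_max_image (S.filter fun τ => ∃ x ∈ U, x ≠ 0 ∧ α x = τ) id
      ⟨α x0, by simp only [Finset.mem_filter]; exact ⟨hU _ hx0 hx0', x0, hx0, hx0', rfl⟩⟩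
    rw [Finset.mem_filter] at hτ
    obtain ⟨hτS, x, hxU, hx, rfl⟩ := hτ
    have hmax' : ∀ y ∈ U, y ≠ 0 → α y ≤ α x := fun y hy hy0 => hmax (α y) (by
      simp only [Finset.mem_filter]; exact ⟨hU _ hy hy0, y, hy, hy0, rfl⟩)
    obtain ⟨C, hC⟩ := Submodule.exists_isCompl (F ∙ x)
    have hle : Module.finrank F U ≤ Module.finrank F ((F ∙ x : Submodule F V)) + Module.finrank F (U ⊓ C : Submodule F V) := by
      have h1 : U ≤ (F ∙ x) ⊔ (U ⊓ C) := by
        intro y hy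
        have : y ∈ (F ∙ x) ⊔ C := by rw [hC.sup_eq_top]; trivial
        obtain ⟨a, ha, b, hb, rfl⟩ := Submodule.mem_sup.1 this
        refine Submodule.mem_sup.2 ⟨a, ha, b, ⟨?_, hb⟩, rfl⟩
        have haU : a ∈ U := (Submodule.span_singleton_le_iff_mem x U).2 hxU ha
        simpa using U.sub_mem hy haU
      exact (Submodule.finrank_mono h1).trans (Submodule.finrank_add_le_finrank_add_finrank _ _)
    have h2 := ih (S.erase (α x)) (U ⊓ C) (by rw [Finset.card_erase_of_mem hτS, hS]; rfl) (by
      intro y hy hy0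
      refine Finset.mem_erase.2 ⟨?_, hU y hy.1 hy0⟩
      intro hyx
      obtain ⟨c, hc⟩ := hα y x hy0 hx hyx
      have hz : y - c • x = 0 := by
        by_contra hne
        have := hc hne
        rw [hyx] at this
        exact absurd this (not_lt.2 (hmax' _ (U.sub_mem hy.1 (U.smul_mem _ hxU)) hne))
      have : y ∈ (F ∙ x) ⊓ C := ⟨by rw [sub_eq_zero.1 hz]; exact Submodule.smul_mem _ _ (Submodule.mem_span_singleton_self x), hy.2⟩
      rw [hC.inf_eq_bot] at this
      exact hy0 this)
    rw [finrank_span_singleton hx] at hle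
    omega

theorem aux_dim2 {F E V Γ : Type*} [Field F] [Field E] [Algebra F E]
    [AddCommGroup Γ] [LinearOrder Γ] [IsOrderedAddMonoid Γ]
    (v : AddValuation E (WithTop Γ)) (hv : ∀ c : F, c ≠ 0 → v (algebraMap F E c) = 0)
    [AddCommGroup V] [Module F V] [FiniteDimensional F V] (W : Submodule F E) [FiniteDimensional F W]
    (f : V → E) (hf0 : ∀ x, x ≠ 0 → f x ≠ 0) (hfW : ∀ x, f x ∈ W)
    (hα : ∀ x y, x ≠ 0 → y ≠ 0 → v (f x) = v (f y) → ∃ c : F, x - c • y ≠ 0 → v (f x) < v (f (x - c • y))) :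
    Module.finrank F V ≤ Module.finrank F W := by
  classical
  let T : Set (WithTop Γ) := {τ | ∃ x, x ≠ 0 ∧ v (f x) = τ}
  choose g hg0 hg using fun τ : T => τ.2
  let x : T → W := fun τ => ⟨f (g τ), hfW _⟩
  have hli : LinearIndependent F x := by
    apply LinearIndependent.of_comp W.subtype
    apply aux_linInd v hv
    · intro i; exact hf0 _ (hg0 i)
    · intro i j hij
      apply Subtype.ext
      have : v (f (g i)) = v (f (g j)) := hij
      rwa [hg, hg] at this
  have := hli.finite
  have := Fintype.ofFinite T
  have h1 := hli.fintype_card_le_finrank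
  have h2 := aux_dim (fun x => v (f x)) hα T.toFinset.card T.toFinset ⊤ rfl (by
    intro x _ hx
    rw [Set.mem_toFinset]
    exact ⟨x, hx, rfl⟩)
  rw [finrank_top, Set.toFinset_card] at h2
  exact h2.trans h1

theorem aux_mul_mono {F E : Type*} [Field F] [Field E] [Algebra F E] {A B C : Submodule F E}
    (h : A ≤ B) : A * C ≤ B * C := mul_le_mul' h le_rfl

theorem aux_alg {F E : Type*} [Field F] [Field E] [Algebra F E] (s : Finset E)
    (hs : Algebra.IsAlgebraic (IntermediateField.adjoin F (s : Set E)) E) (C : Finset E) :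
    ∃ (D : E) (V : ℕ → Submodule F E) (N c : ℕ), D ≠ 0 ∧ (∀ d, FiniteDimensional F (V d)) ∧
      (∀ d, Module.finrank F (V d) ≤ N * (d + 1) ^ s.card) ∧ 0 < Module.finrank F (V 0) ∧
      ∀ d, ∀ γ ∈ C, ∀ x ∈ V d, ∀ y ∈ V d, D * (γ * (x * y)) ∈ V (2 * d + c) := by
  classical
  let R := Algebra.adjoin F (s : Set E)
  open scoped IntermediateField.algebraAdjoinAdjoin in
  have hR : Algebra.IsAlgebraic R E :=
    (IsFractionRing.comap_isAlgebraic_iff (K := IntermediateField.adjoin F (s : Set E))).2 hs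
  obtain ⟨D, hD, hint⟩ := Algebra.IsAlgebraic.exists_integral_multiples R C
  let M := Algebra.adjoin R ((fun z => D • z) '' (C : Set E))
  have hfg : (Subalgebra.toSubmodule M).FG := by
    apply fg_adjoin_of_finite ((Finset.finite_toSet C).image _)
    rintro _ ⟨z, hz, rfl⟩
    exact hint z hz
  obtain ⟨e, he⟩ := hfg
  let P : ℕ → Submodule F E := fun d =>
    Submodule.span F (Set.range fun f : s → Fin (d + 1) => ∏ x : s, (x : E) ^ (f x : ℕ))
  have hPmem : ∀ (d : ℕ) (f : s → ℕ), (∀ x, f x ≤ d) → ∏ x : s, (x : E) ^ f x ∈ P d := by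
    intro d f hf
    apply Submodule.subset_span
    exact ⟨fun x => ⟨f x, Nat.lt_succ_of_le (hf x)⟩, rfl⟩
  have hPmono : ∀ d d', d ≤ d' → P d ≤ P d' := by
    intro d d' h
    apply Submodule.span_le.2
    rintro _ ⟨f, rfl⟩
    exact hPmem d' (fun x => f x) fun x => by have := (f x).2; omega
  have hPmul : ∀ d d', P d * P d' ≤ P (d + d') := by
    intro d d'
    rw [Submodule.span_mul_span]
    apply Submodule.span_le.2
    rintro _ ⟨_, ⟨f, rfl⟩, _, ⟨g, rfl⟩, rfl⟩
    have := hPmem (d + d') (fun x => f x + g x) fun x => by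
      have := (f x).2; have := (g x).2; omega
    simpa [pow_add, Finset.prod_mul_distrib] using this
  have hP1 : ∀ d, (1 : E) ∈ P d := fun d => by
    simpa using hPmem d (fun _ => 0) (fun _ => Nat.zero_le _)
  have hPR : ∀ r ∈ R, ∃ d, r ∈ P d := by
    intro r hr
    induction hr using Algebra.adjoin_induction with
    | mem x hx =>
      refine ⟨1, ?_⟩
      have := hPmem 1 (fun y => if (y : E) = x then 1 else 0) (fun y => by split_ifs <;> simp)
      have h2 : ∏ y : s, (y : E) ^ (if (y : E) = x then 1 else 0) = x := by
        rw [Finset.prod_eq_single (⟨x, hx⟩ : s)]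
        · simp
        · intro b _ hb
          rw [if_neg (fun h => hb (Subtype.ext h)), pow_zero]
        · simp
      rwa [h2] at this
    | algebraMap r => exact ⟨0, by rw [Algebra.algebraMap_eq_smul_one]; exact Submodule.smul_mem _ _ (hP1 0)⟩
    | add x y _ _ hx hy =>
      obtain ⟨d, hd⟩ := hx
      obtain ⟨d', hd'⟩ := hy
      exact ⟨max d d', Submodule.add_mem _ (hPmono _ _ (le_max_left _ _) hd) (hPmono _ _ (le_max_right _ _) hd')⟩
    | mul x y _ _ hx hy =>
      obtain ⟨d, hd⟩ := hx
      obtain ⟨d', hd'⟩ := hy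
      exact ⟨d + d', hPmul _ _ (Submodule.mul_mem_mul hd hd')⟩
  let B : Submodule F E := Submodule.span F (e : Set E)
  let V : ℕ → Submodule F E := fun d => P d * B
  have hVmono : ∀ d d', d ≤ d' → V d ≤ V d' := fun d d' h => aux_mul_mono (hPmono d d' h)
  have hMV : ∀ z ∈ M, ∃ d, z ∈ V d := by
    intro z hz
    have hz' : z ∈ Submodule.span R (e : Set E) := by rw [he]; exact hz
    induction hz' using Submodule.span_induction with
    | mem x hx => exact ⟨0, by simpa using Submodule.mul_mem_mul (hP1 0) (Submodule.subset_span hx : x ∈ B)⟩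
    | zero => exact ⟨0, Submodule.zero_mem _⟩
    | add x y hx' hy' hx hy =>
      rw [he] at hx' hy'
      obtain ⟨d, hd⟩ := hx hx'
      obtain ⟨d', hd'⟩ := hy hy'
      exact ⟨max d d', Submodule.add_mem _ (hVmono _ _ (le_max_left _ _) hd) (hVmono _ _ (le_max_right _ _) hd')⟩
    | smul r x hx' hx =>
      rw [he] at hx'
      obtain ⟨d, hd⟩ := hx hx'
      obtain ⟨d', hd'⟩ := hPR r r.2
      refine ⟨d' + d, ?_⟩
      have h1 : (r : E) * x ∈ P d' * (P d * B) := Submodule.mul_mem_mul hd' hd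
      rw [← mul_assoc] at h1
      exact aux_mul_mono (hPmul _ _) h1
  have heM : ∀ h ∈ e, h ∈ M := by
    intro h hh
    have : h ∈ Submodule.span R (e : Set E) := Submodule.subset_span hh
    rw [he] at this
    exact this
  have hex : ∀ q : C × e × e, ∃ d, (D : E) * (q.1 * (q.2.1 * q.2.2)) ∈ V d := by
    rintro ⟨⟨γ, hγ⟩, ⟨h1, hh1⟩, ⟨h2, hh2⟩⟩
    apply hMV
    rw [← mul_assoc]
    refine M.mul_mem ?_ (M.mul_mem (heM _ hh1) (heM _ hh2))
    exact Algebra.subset_adjoin ⟨γ, hγ, rfl⟩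
  choose dd hdd using hex
  let c := Finset.univ.sup dd
  have hVspan : ∀ d, V d = Submodule.span F (Set.range fun q : (s → Fin (d + 1)) × e =>
      (∏ x : s, (x : E) ^ (q.1 x : ℕ)) * (q.2 : E)) := by
    intro d
    change Submodule.span F _ * Submodule.span F _ = _
    rw [Submodule.span_mul_span]
    congr 1
    ext z
    simp [Set.mem_mul]
  refine ⟨D, V, e.card, c, ?_, ?_, ?_, ?_, ?_⟩
  · exact fun h => hD (Subtype.ext h)
  · intro d
    rw [hVspan]
    exact FiniteDimensional.span_of_finite F (Set.finite_range _)
  · intro d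
    rw [hVspan]
    refine (finrank_range_le_card _).trans ?_
    simp [mul_comm]
  · have hfd : FiniteDimensional F (V 0) := by
      rw [hVspan]
      exact FiniteDimensional.span_of_finite F (Set.finite_range _)
    rw [Module.finrank_pos_iff_exists_ne_zero]
    by_contra! hall
    have h0 : ∀ h ∈ e, h = 0 := by
      intro h hh
      have : h ∈ V 0 := by simpa using Submodule.mul_mem_mul (hP1 0) (Submodule.subset_span hh : h ∈ B)
      exact congrArg Subtype.val (hall ⟨h, this⟩)
    have h1 : (1 : E) ∈ Submodule.span R (e : Set E) := by rw [he]; exact M.one_mem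
    have h2 : Submodule.span R (e : Set E) ≤ ⊥ := Submodule.span_le.2 fun h hh => by simpa using h0 h hh
    exact one_ne_zero (h2 h1)
  · intro d γ hγ x hx y hy
    have hxy : x * y ∈ (P d * P d) * (B * B) := by
      have := Submodule.mul_mem_mul hx hy
      rwa [mul_mul_mul_comm] at this
    have hxy2 : x * y ∈ P (d + d) * (B * B) := aux_mul_mono (hPmul _ _) hxy
    have hBB : ∀ z ∈ B * B, (D : E) * γ * z ∈ V c := by
      intro z hz
      rw [Submodule.span_mul_span] at hz
      induction hz using Submodule.span_induction with
      | mem x hx =>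
        obtain ⟨h1, hh1, h2, hh2, rfl⟩ := hx
        have := hdd ⟨⟨γ, hγ⟩, ⟨h1, hh1⟩, ⟨h2, hh2⟩⟩
        rw [← mul_assoc] at this
        exact hVmono _ _ (Finset.le_sup (Finset.mem_univ _)) this
      | zero => simp
      | add x y _ _ hx hy => rw [mul_add]; exact Submodule.add_mem _ hx hy
      | smul r x _ hx => rw [mul_smul_comm]; exact Submodule.smul_mem _ _ hx
    rw [← mul_assoc]
    refine Submodule.mul_induction_on (C := fun t => (D : E) * γ * t ∈ V (2 * d + c)) hxy2 ?_ ?_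
    · intro p hp z hz
      have h1 : p * ((D : E) * γ * z) ∈ P (d + d) * (P c * B) := Submodule.mul_mem_mul hp (hBB z hz)
      rw [← mul_assoc (P (d + d))] at h1
      have h2 := aux_mul_mono (hPmul _ _) h1
      rw [two_mul]
      convert h2 using 1
      ring
    · intro x y hx hy
      rw [mul_add]; exact Submodule.add_mem _ hx hy

theorem aux_two_inj {Γ : Type*} [AddCommGroup Γ] [LinearOrder Γ] [IsOrderedAddMonoid Γ] {g h : Γ}
    (H : g + g = h + h) : g = h := by
  rcases lt_trichotomy g h with h1 | h1 | h1
  · exact absurd H (add_lt_add h1 h1).ne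
  · exact h1
  · exact absurd H (add_lt_add h1 h1).ne'

def auxForm {Γ F : Type*} [AddCommGroup Γ] [LinearOrder Γ] [IsOrderedAddMonoid Γ] [Field F] {J : Type*}
    [Fintype J] (w : J × Bool → Γ) (x : J × Bool → HahnSeries Γ F) : HahnSeries Γ F :=
  ∑ j, HahnSeries.single (w j) 1 * (x j * x j) +
    ∑ S, HahnSeries.single (w (S, false)) 1 * (x (S, false) * x (S, true))

theorem aux_val {Γ F : Type*} [AddCommGroup Γ] [LinearOrder Γ] [IsOrderedAddMonoid Γ] [Field F]
    (g : Γ) (x y : HahnSeries Γ F) (hx : x ≠ 0) (hy : y ≠ 0) :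
    HahnSeries.addVal Γ F (HahnSeries.single g 1 * (x * y)) = ((g + (x.order + y.order) : Γ) : WithTop Γ) := by
  rw [AddValuation.map_mul, AddValuation.map_mul, HahnSeries.addVal_apply_of_ne hx,
    HahnSeries.addVal_apply_of_ne hy, HahnSeries.addVal_apply, HahnSeries.orderTop_single one_ne_zero]
  rfl

theorem aux_H1 {Γ F : Type*} [AddCommGroup Γ] [LinearOrder Γ] [IsOrderedAddMonoid Γ] [Field F] {J : Type*}
    [Fintype J] (w : J × Bool → Γ)
    (hw : ∀ i j g h, w i + (g + g) = w j + (h + h) → i = j)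
    (hw2 : ∀ S, w (S, true) < w (S, false)) (x : J × Bool → HahnSeries Γ F) (hx : x ≠ 0) :
    ∃ j, x j ≠ 0 ∧ HahnSeries.addVal Γ F (auxForm w x) = ((w j + ((x j).order + (x j).order) : Γ) : WithTop Γ) ∧
      ∀ i, HahnSeries.addVal Γ F (auxForm w x) ≤ HahnSeries.addVal Γ F (HahnSeries.single (w i) 1 * (x i * x i)) := by
  classical
  obtain ⟨i0, hi0⟩ := Function.ne_iff.1 hx
  obtain ⟨j, hj, hmin⟩ := Finset.exists_min_image (Finset.univ.filter fun i => x i ≠ 0)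
    (fun i => w i + ((x i).order + (x i).order)) ⟨i0, by simpa using hi0⟩
  simp only [Finset.mem_filter, Finset.mem_univ, true_and] at hj hmin
  set μ : Γ := w j + ((x j).order + (x j).order) with hμ
  have hlt : ∀ i, i ≠ j → (μ : WithTop Γ) < HahnSeries.addVal Γ F (HahnSeries.single (w i) 1 * (x i * x i)) := by
    intro i hij
    by_cases h : x i = 0
    · rw [h, zero_mul, mul_zero, AddValuation.map_zero]; exact WithTop.coe_lt_top _
    · rw [aux_val _ _ _ h h, WithTop.coe_lt_coe]
      exact lt_of_le_of_ne (hmin i h) fun h' => hij (hw _ _ _ _ h').symm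
  have hcross : ∀ S, (μ : WithTop Γ) < HahnSeries.addVal Γ F
      (HahnSeries.single (w (S, false)) 1 * (x (S, false) * x (S, true))) := by
    intro S
    by_cases h : x (S, false) = 0
    · rw [h, zero_mul, mul_zero, AddValuation.map_zero]; exact WithTop.coe_lt_top _
    by_cases h' : x (S, true) = 0
    · rw [h', mul_zero, mul_zero, AddValuation.map_zero]; exact WithTop.coe_lt_top _
    rw [aux_val _ _ _ h h', WithTop.coe_lt_coe]
    have h1 := hmin _ h
    have h2 := hmin _ h'
    have h3 := hw2 S
    by_contra! hcon
    have h4 := add_le_add hcon hcon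
    have h5 := add_le_add h1 h2
    have h6 := h4.trans h5
    have h7 : w (S, false) + ((x (S, false)).order + (x (S, false)).order) +
       (w (S, true) + ((x (S, true)).order + (x (S, true)).order)) <
       w (S, false) + ((x (S, false)).order + (x (S, false)).order) +
       (w (S, false) + ((x (S, true)).order + (x (S, true)).order)) := by gcongr
    refine absurd (h6.trans_lt h7) (not_lt.2 (le_of_eq ?_))
    abel
  have hval : HahnSeries.addVal Γ F (auxForm w x) = (μ : WithTop Γ) := by
    have hjv : HahnSeries.addVal Γ F (HahnSeries.single (w j) 1 * (x j * x j)) = μ := aux_val _ _ _ hj hj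
    have hr : (μ : WithTop Γ) < HahnSeries.addVal Γ F
      (∑ i ∈ Finset.univ.erase j, HahnSeries.single (w i) 1 * (x i * x i) +
        ∑ S, HahnSeries.single (w (S, false)) 1 * (x (S, false) * x (S, true))) := by
      apply AddValuation.map_lt_add
      · exact AddValuation.map_lt_sum _ WithTop.coe_ne_top fun i hi => hlt i (Finset.ne_of_mem_erase hi)
      · exact AddValuation.map_lt_sum _ WithTop.coe_ne_top fun i hi => hcross i
    rw [auxForm, ← Finset.add_sum_erase _ _ (Finset.mem_univ j), add_assoc,
      AddValuation.map_add_eq_of_lt_left _ (by rw [hjv]; exact hr), hjv]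
  refine ⟨j, hj, hval, fun i => ?_⟩
  rw [hval]
  by_cases hij : i = j
  · rw [hij, aux_val _ _ _ hj hj]
  · exact (hlt i hij).le

theorem aux_H2 {Γ F : Type*} [AddCommGroup Γ] [LinearOrder Γ] [IsOrderedAddMonoid Γ] [Field F] {J : Type*}
    [Fintype J] (w : J × Bool → Γ)
    (hw : ∀ i j g h, w i + (g + g) = w j + (h + h) → i = j)
    (hw2 : ∀ S, w (S, true) < w (S, false)) (x y : J × Bool → HahnSeries Γ F) (hx : x ≠ 0) (hy : y ≠ 0)
    (hxy : HahnSeries.addVal Γ F (auxForm w x) = HahnSeries.addVal Γ F (auxForm w y)) :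
    ∃ c : F, x - c • y ≠ 0 →
      HahnSeries.addVal Γ F (auxForm w x) < HahnSeries.addVal Γ F (auxForm w (x - c • y)) := by
  obtain ⟨j, hj, hjv, hjmin⟩ := aux_H1 w hw hw2 x hx
  obtain ⟨j', hj', hjv', hjmin'⟩ := aux_H1 w hw hw2 y hy
  have he := hxy
  rw [hjv, hjv', WithTop.coe_inj] at he
  obtain rfl := hw _ _ _ _ he
  have ho := aux_two_inj (add_left_cancel he)
  refine ⟨(x j).coeff (x j).order / (y j).coeff (y j).order, fun hz => ?_⟩
  set c := (x j).coeff (x j).order / (y j).coeff (y j).order with hc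
  set z := x - c • y with hzdef
  obtain ⟨i, hi, hiv, -⟩ := aux_H1 w hw hw2 z hz
  have hle : HahnSeries.addVal Γ F (auxForm w x) ≤ HahnSeries.addVal Γ F (auxForm w z) := by
    have h1 : min (HahnSeries.addVal Γ F (x i)) (HahnSeries.addVal Γ F (y i)) ≤ HahnSeries.addVal Γ F (z i) := by
      have h2 := (HahnSeries.addVal Γ F).map_sub (x i) (c • y i)
      refine le_trans ?_ h2
      apply min_le_min le_rfl
      rw [HahnSeries.addVal_apply, HahnSeries.addVal_apply]
      exact HahnSeries.orderTop_le_orderTop_smul _ _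
    rw [hiv, ← aux_val _ _ _ hi hi]
    rcases min_le_iff.1 h1 with h | h
    · refine (hjmin i).trans ?_
      simp only [AddValuation.map_mul]
      gcongr
    · rw [hxy]
      refine (hjmin' i).trans ?_
      simp only [AddValuation.map_mul]
      gcongr
  refine lt_of_le_of_ne hle fun heq => ?_
  rw [hjv, hiv, WithTop.coe_inj] at heq
  obtain rfl := hw _ _ _ _ heq
  have ho' := aux_two_inj (add_left_cancel heq)
  have h0 : (z j).coeff (z j).order ≠ 0 := by rw [Ne, HahnSeries.coeff_order_eq_zero]; exact hi
  apply h0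
  rw [← ho']
  have hy0 : (y j).coeff (y j).order ≠ 0 := by rw [Ne, HahnSeries.coeff_order_eq_zero]; exact hj'
  simp only [hzdef, Pi.sub_apply, Pi.smul_apply, HahnSeries.coeff_sub, HahnSeries.coeff_smul, smul_eq_mul]
  rw [hc]
  rw [ho] at *
  field_simp
  simp

theorem aux_upper (F : Type u) [Field F] (n : ℕ) (hn : 1 ≤ n) : pfisterEdLE F n n := by
  classical
  intro K _ _ a b
  let T : Finset K := insert b (Finset.univ.image fun i => (a i : K))
  let E := IntermediateField.adjoin F (T : Set K)
  have hT : ∀ x ∈ T, x ∈ E := fun x hx => IntermediateField.subset_adjoin F _ hx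
  have hb : b ∈ E := hT _ (by simp [T])
  have ha : ∀ i, (a i : K) ∈ E := fun i => hT _ (by simp [T])
  refine ⟨E, ⟨insert ⟨b, hb⟩ (Finset.univ.image fun i => (⟨a i, ha i⟩ : E)), ?_, ?_⟩,
    fun i => Units.mk0 ⟨a i, ha i⟩ (fun h => (a i).ne_zero (congrArg Subtype.val h)), ⟨b, hb⟩, ?_⟩
  · refine (Finset.card_insert_le _ _).trans ?_
    have := Finset.card_image_le (s := (Finset.univ : Finset (Fin (n - 1)))) (f := fun i => (⟨a i, ha i⟩ : E))
    simp only [Finset.card_univ, Fintype.card_fin] at this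
    omega
  · set s : Finset E := insert ⟨b, hb⟩ (Finset.univ.image fun i => (⟨a i, ha i⟩ : E)) with hs
    refine ⟨fun x => ?_⟩
    have hx : x ∈ IntermediateField.adjoin F (s : Set E) := by
      rw [← IntermediateField.mem_lift, IntermediateField.lift_adjoin]
      have h1 : (Subtype.val '' (s : Set E)) = (T : Set K) := by
        ext y
        simp [hs, T, Set.mem_image]
        rw [eq_comm]
      have := x.2
      convert this
    exact isAlgebraic_algebraMap (⟨x, hx⟩ : IntermediateField.adjoin F (s : Set E))
  · exact QuadraticMap.Equivalent.refl _

theorem aux_single_prod {Γ F I : Type*} [AddCommGroup Γ] [LinearOrder Γ] [IsOrderedAddMonoid Γ] [Field F]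
    (s : Finset I) (g : I → Γ) (p : I → Bool) :
    (∏ i ∈ s, if p i then (HahnSeries.single (g i) 1 : HahnSeries Γ F) else 1) =
      HahnSeries.single (∑ i ∈ s, if p i then g i else 0) 1 := by
  classical
  induction s using Finset.induction_on with
  | empty => rfl
  | insert i s hi ih =>
    rw [Finset.prod_insert hi, Finset.sum_insert hi, ih]
    split_ifs
    · rw [HahnSeries.single_mul_single, one_mul]
    · rw [one_mul, zero_add]

def auxG (k : ℕ) (i : Fin (k + 1)) : Lex (Fin (k + 1) → ℤ) := toLex (Pi.single i 1)

def auxW (k : ℕ) (r : (Fin k → Bool) × Bool) : Lex (Fin (k + 1) → ℤ) :=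
  (∑ i, if r.1 i then auxG k i.succ else 0) + if r.2 then - auxG k 0 else 0

theorem auxW_zero (k : ℕ) (r : (Fin k → Bool) × Bool) : ofLex (auxW k r) 0 = if r.2 then -1 else 0 := by
  have h : ofLex (∑ i, if r.1 i then auxG k i.succ else 0) 0 = 0 := by
    change (∑ i, if r.1 i then (Pi.single i.succ 1 : Fin (k + 1) → ℤ) else 0) 0 = 0
    rw [Finset.sum_apply]
    refine Finset.sum_eq_zero fun i _ => ?_
    split_ifs <;> simp
  change ofLex (∑ i, if r.1 i then auxG k i.succ else 0) 0 + ofLex (if r.2 then - auxG k 0 else 0) 0 = _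
  rw [h]
  split_ifs
  · change 0 + - ((Pi.single 0 1 : Fin (k + 1) → ℤ) 0) = -1
    simp
  · rfl

theorem auxW_succ (k : ℕ) (r : (Fin k → Bool) × Bool) (j : Fin k) :
    ofLex (auxW k r) j.succ = if r.1 j then 1 else 0 := by
  have h : ofLex (∑ i, if r.1 i then auxG k i.succ else 0) j.succ = if r.1 j then 1 else 0 := by
    change (∑ i, if r.1 i then (Pi.single i.succ 1 : Fin (k + 1) → ℤ) else 0) j.succ = _
    rw [Finset.sum_apply, Finset.sum_eq_single j]
    · split_ifs <;> simp
    · intro i _ hi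
      split_ifs
      · exact Pi.single_eq_of_ne (fun h => hi (Fin.succ_injective _ h).symm) _
      · rfl
    · simp
  change ofLex (∑ i, if r.1 i then auxG k i.succ else 0) j.succ + ofLex (if r.2 then - auxG k 0 else 0) j.succ = _
  rw [h]
  have h2 : ofLex (if r.2 then - auxG k 0 else 0) j.succ = 0 := by
    split_ifs
    · change - ((Pi.single 0 1 : Fin (k + 1) → ℤ) j.succ) = 0
      simp
    · rfl
  rw [h2, add_zero]

theorem auxW_inj (k : ℕ) (i j : (Fin k → Bool) × Bool) (g h : Lex (Fin (k + 1) → ℤ))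
    (H : auxW k i + (g + g) = auxW k j + (h + h)) : i = j := by
  have H' : ∀ l, ofLex (auxW k i) l + (ofLex g l + ofLex g l) = ofLex (auxW k j) l + (ofLex h l + ofLex h l) :=
    fun l => congrFun H l
  refine Prod.ext (funext fun l => ?_) ?_
  · have := H' l.succ
    rw [auxW_succ, auxW_succ] at this
    cases h1 : i.1 l <;> cases h2 : j.1 l <;> simp [h1, h2] at this ⊢ <;> omega
  · have := H' 0
    rw [auxW_zero, auxW_zero] at this
    cases h1 : i.2 <;> cases h2 : j.2 <;> simp [h1, h2] at this ⊢ <;> omega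

theorem auxW_lt (k : ℕ) (S : Fin k → Bool) : auxW k (S, true) < auxW k (S, false) := by
  have : (0 : Lex (Fin (k + 1) → ℤ)) < auxG k 0 := by
    refine ⟨0, fun j hj => absurd hj (Fin.not_lt_zero j), ?_⟩
    change (0 : ℤ) < (Pi.single 0 1 : Fin (k + 1) → ℤ) 0
    simp
  simpa [auxW] using this

theorem aux_form_eq (F : Type*) [Field F] (k : ℕ)
    (x : (Fin k → Bool) × Bool → HahnSeries (Lex (Fin (k + 1) → ℤ)) F) :
    quadPfister (fun i : Fin k => (HahnSeries.single (auxG k i.succ) 1 : HahnSeries (Lex (Fin (k + 1) → ℤ)) F))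
      (HahnSeries.single (- auxG k 0) 1) x = auxForm (auxW k) x := by
  have h : ∀ r : (Fin k → Bool) × Bool, pfisterMatrix
      (fun i : Fin k => (HahnSeries.single (auxG k i.succ) 1 : HahnSeries (Lex (Fin (k + 1) → ℤ)) F))
      (HahnSeries.single (- auxG k 0) 1) r r = HahnSeries.single (auxW k r) 1 := by
    intro r
    simp only [pfisterMatrix, if_true, aux_single_prod, auxW]
    split_ifs
    · rw [HahnSeries.single_mul_single, one_mul]
    · rw [mul_one, add_zero]
  rw [aux_quad2, auxForm]
  simp only [h]

theorem aux_map {E K : Type*} [Field E] [Field K] (f : E →+* K) {m : ℕ} (a : Fin m → E) (b : E) (x) :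
    f (quadPfister a b x) = quadPfister (fun i => f (a i)) (f b) (fun i => f (x i)) := by
  rw [aux_quad, aux_quad]
  simp only [map_sum, map_mul]
  refine Finset.sum_congr rfl fun i _ => Finset.sum_congr rfl fun j _ => ?_
  congr 1
  simp only [pfisterMatrix]
  split_ifs <;> simp [map_prod, apply_ite f]

theorem aux_abs {F K Γ : Type*} [Field F] [Field K] [Algebra F K]
    [AddCommGroup Γ] [LinearOrder Γ] [IsOrderedAddMonoid Γ]
    (vK : AddValuation K (WithTop Γ)) (hvK : ∀ c : F, c ≠ 0 → vK (algebraMap F K c) = 0)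
    (k : ℕ) (Q : QuadraticForm K ((Fin k → Bool) × Bool → K)) (hQ1 : ∀ x, x ≠ 0 → Q x ≠ 0)
    (hQ2 : ∀ x y, x ≠ 0 → y ≠ 0 → vK (Q x) = vK (Q y) → ∃ c : F, x - algebraMap F K c • y ≠ 0 →
      vK (Q x) < vK (Q (x - algebraMap F K c • y)))
    (E : IntermediateField F K) (s : Finset E) (hs : s.card < k + 1)
    (halg : Algebra.IsAlgebraic (IntermediateField.adjoin F (s : Set E)) E)
    (a' : Fin k → E) (b' : E)
    (iso : QuadraticMap.IsometryEquiv
      (quadPfister (fun i => algebraMap E K (a' i)) (algebraMap E K b')) Q) : False := by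
  classical
  obtain ⟨D, V, N, c, hD, hfd, hN, h0, hmul⟩ := aux_alg s halg
    (Finset.univ.image fun q : ((Fin k → Bool) × Bool) × ((Fin k → Bool) × Bool) => pfisterMatrix a' b' q.1 q.2)
  obtain ⟨d, hd⟩ := aux_growth (fun d => Module.finrank F (V d)) N s.card h0 hN c
  let v : AddValuation E (WithTop Γ) := vK.comap (algebraMap E K)
  let ψ : ((Fin k → Bool) × Bool → V d) → E := fun x => quadPfister a' b' (fun i => (x i : E))
  let G : ((Fin k → Bool) × Bool → V d) → ((Fin k → Bool) × Bool → K) :=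
    fun x => iso.toLinearEquiv (fun i => algebraMap E K (x i : E))
  have hG0 : ∀ x, x ≠ 0 → G x ≠ 0 := by
    intro x hx h
    apply hx
    have h1 : (fun i => algebraMap E K (x i : E)) = 0 := (LinearEquiv.map_eq_zero_iff _).1 h
    funext i
    have h2 := congrFun h1 i
    exact Subtype.ext ((map_eq_zero (algebraMap E K)).1 h2)
  have hGsub : ∀ x y (c : F), G (x - c • y) = G x - algebraMap F K c • G y := by
    intro x y c
    have h1 : (fun i => algebraMap E K (((x - c • y) i : V d) : E)) =
       (fun i => algebraMap E K (x i : E)) - (algebraMap F K c) • (fun i => algebraMap E K (y i : E)) := by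
      funext i
      simp [Algebra.smul_def]
    change iso.toLinearEquiv (fun i => algebraMap E K (((x - c • y) i : V d) : E)) = _
    rw [h1, map_sub, map_smul]
  have hψ : ∀ x, algebraMap E K (ψ x) = Q (G x) := by
    intro x
    have h1 := iso.map_app (fun i => algebraMap E K (x i : E))
    refine Eq.trans ?_ h1.symm
    exact aux_map (algebraMap E K) _ _ _
  have hψv : ∀ x, v (D * ψ x) = v D + vK (Q (G x)) := by
    intro x
    rw [v.map_mul, ← hψ]
    rfl
  have hvD : v D ≠ ⊤ := by rw [Ne, v.top_iff]; exact hD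
  have hfin : ∀ x, x ≠ 0 → D * ψ x ≠ 0 := by
    intro x hx h
    rcases mul_eq_zero.1 h with h | h
    · exact hD h
    · have h1 := hψ x
      rw [h, map_zero] at h1
      exact hQ1 _ (hG0 x hx) h1.symm
  have hmain := aux_dim2 (F := F) v (fun c hc => by
    change vK (algebraMap E K (algebraMap F E c)) = 0
    rw [← IsScalarTower.algebraMap_apply]; exact hvK c hc) (V (2 * d + c)) (fun x => D * ψ x) hfin ?_ ?_
  · rw [Module.finrank_pi_fintype] at hmain
    simp only [Finset.sum_const, Finset.card_univ, smul_eq_mul] at hmain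
    have hcard : Fintype.card ((Fin k → Bool) × Bool) = 2 ^ (k + 1) := by simp [pow_succ]
    rw [hcard] at hmain
    have h2 : 2 ^ (s.card + 1) ≤ 2 ^ (k + 1) := Nat.pow_le_pow_right (by norm_num) (by omega)
    have h3 := Nat.mul_le_mul_right (Module.finrank F (V d)) h2
    omega
  · intro x
    simp only [ψ]
    rw [aux_quad, Finset.mul_sum]
    refine Submodule.sum_mem _ fun i _ => ?_
    rw [Finset.mul_sum]
    refine Submodule.sum_mem _ fun j _ => ?_
    exact hmul d _ (Finset.mem_image.2 ⟨(i, j), Finset.mem_univ _, rfl⟩) _ (x i).2 _ (x j).2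
  · intro x y hx hy hxy
    rw [hψv, hψv] at hxy
    have hxy' := WithTop.add_left_cancel hvD hxy
    obtain ⟨c, hc⟩ := hQ2 (G x) (G y) (hG0 x hx) (hG0 y hy) hxy'
    refine ⟨c, fun hz => ?_⟩
    rw [hψv, hψv, hGsub]
    refine WithTop.add_lt_add_left hvD (hc ?_)
    rw [← hGsub]
    exact hG0 _ hz

theorem aux_lower (F : Type u) [Field F] (k m : ℕ) (hE : pfisterEdLE F (k + 1) m) : k + 1 ≤ m := by
  by_contra! hlt
  have hne : ∀ i : Fin k, (HahnSeries.single (auxG k i.succ) 1 : HahnSeries (Lex (Fin (k + 1) → ℤ)) F) ≠ 0 :=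
    fun i => by rw [Ne, HahnSeries.single_eq_zero_iff]; exact one_ne_zero
  obtain ⟨E, ⟨s, hs, halg⟩, a', b', ⟨iso⟩⟩ := hE (HahnSeries (Lex (Fin (k + 1) → ℤ)) F)
    (fun i => Units.mk0 _ (hne i)) (HahnSeries.single (- auxG k 0) 1)
  refine aux_abs (HahnSeries.addVal (Lex (Fin (k + 1) → ℤ)) F) ?_ k
    (quadPfister (fun i : Fin k => (HahnSeries.single (auxG k i.succ) 1 : HahnSeries (Lex (Fin (k + 1) → ℤ)) F))
      (HahnSeries.single (- auxG k 0) 1)) ?_ ?_ E s (by omega) halg (fun i => (a' i : E)) b' iso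
  · intro c hc
    rw [HahnSeries.addVal_apply]
    change (HahnSeries.single 0 c).orderTop = 0
    rw [HahnSeries.orderTop_single hc]
    rfl
  · intro x hx h
    obtain ⟨j, -, hj, -⟩ := aux_H1 (auxW k) (auxW_inj k) (auxW_lt k) x hx
    rw [aux_form_eq] at h
    rw [h, AddValuation.map_zero] at hj
    exact WithTop.coe_ne_top hj.symm
  · intro x y hx hy hxy
    rw [aux_form_eq, aux_form_eq] at hxy
    obtain ⟨c, hc⟩ := aux_H2 (auxW k) (auxW_inj k) (auxW_lt k) x y hx hy hxy
    refine ⟨c, fun hz => ?_⟩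
    have h2 : algebraMap F (HahnSeries (Lex (Fin (k + 1) → ℤ)) F) c • y = c • y := by
      funext i
      exact (Algebra.smul_def c (y i)).symm
    rw [h2] at hz ⊢
    rw [aux_form_eq, aux_form_eq]
    exact hc hz

/-- Over a field `F` of characteristic `2`, the essential dimension of the
functor `P_n` of isomorphism classes of `n`-fold quadratic Pfister forms equals `n`:
`ed(P_n) ≤ n`, and `n ≤ m` for every `m` with `ed(P_n) ≤ m`. -/
theorem ed_pfister_eq (F : Type u) [Field F] [CharP F 2] (n : ℕ) (hn : 1 ≤ n) :
    pfisterEdLE F n n ∧ ∀ m : ℕ, pfisterEdLE F n m → n ≤ m := by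
  refine ⟨aux_upper F n hn, fun m hm => ?_⟩
  obtain ⟨k, rfl⟩ : ∃ k, n = k + 1 := ⟨n - 1, by omega⟩
  exact aux_lower F k m hm

end
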